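/- Let L > 0, let p denote the Neumann heat kernel on [0,L], define the operator (𝒫ψ)(t,x) := ∫₀ᵗ ∫₀ᴸ [p_{t−s}(x,y)]² ψ(s,y) dy ds acting on nonnegative Borel functions ψ : (0,∞) × [0,L] → ℝ₊, and let 𝟏(t,x) := 1 with 𝒫⁰𝟏 := 𝟏. Then for every a > 0 and every t > 0, ∑_{k=0}^∞ aᵏ ∫₀ᴸ (𝒫ᵏ𝟏)(t,x) dx ≥ L · exp(a² t/(4πe)). -/

import Mathlib

open MeasureTheory Real

/-- The Gaussian heat kernel on `ℝ`: `Γ_t(z) = (4πt)^{-1/2} exp(-z²/(4t))`. -/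
noncomputable def heatGauss (t z : ℝ) : ℝ :=
  Real.exp (-z ^ 2 / (4 * t)) / Real.sqrt (4 * π * t)

/-- The Neumann heat kernel on `[0, L]`, obtained by the method of images:
`p_t(x,y) = ∑_{n ∈ ℤ} [Γ_t(x-y-2nL) + Γ_t(x+y-2nL)]`. -/
noncomputable def neumannHeatKernel (L t x y : ℝ) : ℝ :=
  ∑' n : ℤ, (heatGauss t (x - y - 2 * (n : ℝ) * L) + heatGauss t (x + y - 2 * (n : ℝ) * L))

/-- The operator `(𝒫ψ)(t,x) = ∫₀ᵗ ∫₀ᴸ [p_{t-s}(x,y)]² ψ(s,y) dy ds`. -/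
noncomputable def heatSqOp (L : ℝ) (ψ : ℝ → ℝ → ℝ) : ℝ → ℝ → ℝ :=
  fun t x =>
    ∫ s in (0 : ℝ)..t, ∫ y in (0 : ℝ)..L, (neumannHeatKernel L (t - s) x y) ^ 2 * ψ s y

open Set
open scoped ENNReal

/-- The Neumann heat kernel on `[0, L]` as an extended nonnegative real. -/
noncomputable def neumannHeatKernelENN (L t x y : ℝ) : ℝ≥0∞ :=
  ∑' n : ℤ, (ENNReal.ofReal (heatGauss t (x - y - 2 * (n : ℝ) * L)) +
    ENNReal.ofReal (heatGauss t (x + y - 2 * (n : ℝ) * L)))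

/-- The operator `heatSqOp` as a Lebesgue integral on extended nonnegative functions. -/
noncomputable def heatSqOpENN (L : ℝ) (ψ : ℝ → ℝ → ℝ≥0∞) : ℝ → ℝ → ℝ≥0∞ :=
  fun t x => ∫⁻ s in Ioc 0 t, ∫⁻ y in Ioc 0 L, neumannHeatKernelENN L (t - s) x y ^ 2 * ψ s y

lemma heatGauss_nonneg (t z : ℝ) : 0 ≤ heatGauss t z := by
  unfold heatGauss; positivity

lemma heatGauss_of_nonpos {t : ℝ} (ht : t ≤ 0) (z : ℝ) : heatGauss t z = 0 := by
  have : √(4 * π * t) = 0 := Real.sqrt_eq_zero_of_nonpos (by nlinarith [Real.pi_pos])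
  simp [heatGauss, this]

lemma measurable_heatGauss : Measurable fun p : ℝ × ℝ => heatGauss p.1 p.2 := by
  unfold heatGauss; fun_prop

lemma neumannHeatKernel_eq_toReal (L t x y : ℝ) :
    neumannHeatKernel L t x y = (neumannHeatKernelENN L t x y).toReal := by
  unfold neumannHeatKernel neumannHeatKernelENN
  rw [ENNReal.tsum_toReal_eq (by simp)]
  congr 1 with n
  rw [ENNReal.toReal_add (by simp) (by simp), ENNReal.toReal_ofReal (heatGauss_nonneg _ _),
    ENNReal.toReal_ofReal (heatGauss_nonneg _ _)]

lemma neumannHeatKernelENN_of_nonpos {t : ℝ} (ht : t ≤ 0) (L x y : ℝ) :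
    neumannHeatKernelENN L t x y = 0 := by
  simp [neumannHeatKernelENN, heatGauss_of_nonpos ht]

lemma measurable_neumannHeatKernelENN (L : ℝ) :
    Measurable fun p : ℝ × ℝ × ℝ => neumannHeatKernelENN L p.1 p.2.1 p.2.2 := by
  unfold neumannHeatKernelENN
  refine Measurable.tsum fun n => ?_
  refine Measurable.add (M := ℝ≥0∞) ?_ ?_
  · exact (measurable_heatGauss.comp (g := fun p : ℝ × ℝ => heatGauss p.1 p.2)
      (f := fun p : ℝ × ℝ × ℝ => (p.1, p.2.1 - p.2.2 - 2 * (n : ℝ) * L)) (by fun_prop)).ennreal_ofReal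
  · exact (measurable_heatGauss.comp (g := fun p : ℝ × ℝ => heatGauss p.1 p.2)
      (f := fun p : ℝ × ℝ × ℝ => (p.1, p.2.1 + p.2.2 - 2 * (n : ℝ) * L)) (by fun_prop)).ennreal_ofReal

lemma measurable_heatSqOpENN_integrand (L : ℝ) {ψ : ℝ → ℝ → ℝ≥0∞}
    (hψ : Measurable fun p : ℝ × ℝ => ψ p.1 p.2) :
    Measurable fun q : ((ℝ × ℝ) × ℝ) × ℝ =>
      neumannHeatKernelENN L (q.1.1.1 - q.1.2) q.1.1.2 q.2 ^ 2 * ψ q.1.2 q.2 := by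
  refine Measurable.mul (Measurable.pow_const ?_ 2) ?_
  · exact (measurable_neumannHeatKernelENN L).comp
      (f := fun q : ((ℝ × ℝ) × ℝ) × ℝ => (q.1.1.1 - q.1.2, q.1.1.2, q.2)) (by fun_prop)
  · exact hψ.comp (f := fun q : ((ℝ × ℝ) × ℝ) × ℝ => (q.1.2, q.2)) (by fun_prop)

lemma measurable_heatSqOpENN (L : ℝ) {ψ : ℝ → ℝ → ℝ≥0∞}
    (hψ : Measurable fun p : ℝ × ℝ => ψ p.1 p.2) :
    Measurable fun p : ℝ × ℝ => heatSqOpENN L ψ p.1 p.2 := by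
  have h1 := (measurable_heatSqOpENN_integrand L hψ).lintegral_prod_right'
    (ν := volume.restrict (Ioc 0 L))
  have hs : MeasurableSet {q : (ℝ × ℝ) × ℝ | q.2 ∈ Ioc 0 q.1.1} :=
    (measurableSet_lt measurable_const measurable_snd).inter
      (measurableSet_le measurable_snd (by fun_prop))
  have h2 := (h1.indicator hs).lintegral_prod_right' (ν := volume)
  convert h2 using 2 with p
  unfold heatSqOpENN
  rw [← lintegral_indicator measurableSet_Ioc]
  rfl

lemma measurable_iterate_heatSqOpENN (L : ℝ) (k : ℕ) :
    Measurable fun p : ℝ × ℝ => ((heatSqOpENN L)^[k] fun _ _ => 1) p.1 p.2 := by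
  induction k with
  | zero => exact measurable_const
  | succ k ih =>
    rw [Function.iterate_succ_apply']
    exact measurable_heatSqOpENN L ih

/-- Unfolding along the reflections `y ↦ -y` and the translations by `2L`. -/
lemma setLIntegral_tsum_images {L : ℝ} (hL : 0 < L) (x : ℝ) {f : ℝ → ℝ≥0∞} (hf : Measurable f) :
    ∫⁻ y in Ioc 0 L, ∑' n : ℤ, (f (x - y - 2 * (n : ℝ) * L) + f (x + y - 2 * (n : ℝ) * L)) =
      ∫⁻ z, f z := by
  have key (n : ℤ) :
      ∫⁻ y in Ioc 0 L, (f (x - y - 2 * ((-n : ℤ) : ℝ) * L) + f (x + y - 2 * ((-n : ℤ) : ℝ) * L)) =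
        ∫⁻ z in Ioc (x - L + n • (2 * L)) (x - L + (n + 1) • (2 * L)), f z := by
    have h1 : ∫⁻ y in Ioc 0 L, f (x - y - 2 * ((-n : ℤ) : ℝ) * L) =
        ∫⁻ z in Ioc (x - L + n • (2 * L)) (x + n • (2 * L)), f z := by
      rw [setLIntegral_congr (Ico_ae_eq_Ioc (μ := volume) (a := x - L + n • (2 * L))).symm,
        ← (Measure.measurePreserving_sub_left volume (x + n • (2 * L))).setLIntegral_comp_preimage
          measurableSet_Ico hf, preimage_const_sub_Ico]
      rw [show x + n • (2 * L) - (x + n • (2 * L)) = 0 by ring,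
        show x + n • (2 * L) - (x - L + n • (2 * L)) = L by ring]
      refine lintegral_congr fun y => congrArg f ?_
      simp only [zsmul_eq_mul, Int.cast_neg]
      ring
    have h2 : ∫⁻ y in Ioc 0 L, f (x + y - 2 * ((-n : ℤ) : ℝ) * L) =
        ∫⁻ z in Ioc (x + n • (2 * L)) (x - L + (n + 1) • (2 * L)), f z := by
      rw [← (measurePreserving_add_left volume (x + n • (2 * L))).setLIntegral_comp_preimage
          measurableSet_Ioc hf, preimage_const_add_Ioc]
      rw [show x + n • (2 * L) - (x + n • (2 * L)) = 0 by ring,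
        show x - L + (n + 1) • (2 * L) - (x + n • (2 * L)) = L by
          simp only [zsmul_eq_mul, Int.cast_add, Int.cast_one]; ring]
      refine lintegral_congr fun y => congrArg f ?_
      simp only [zsmul_eq_mul, Int.cast_neg]
      ring
    rw [lintegral_add_left (by fun_prop), h1, h2, ← lintegral_union measurableSet_Ioc
      (Ioc_disjoint_Ioc_of_le le_rfl), Ioc_union_Ioc_eq_Ioc]
    · linarith
    · simp; linarith
  rw [lintegral_tsum fun n => by fun_prop, ← (Equiv.neg ℤ).tsum_eq]
  simp only [Equiv.neg_apply]
  simp_rw [key]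
  rw [← lintegral_iUnion (fun _ => measurableSet_Ioc) (pairwise_disjoint_Ioc_add_zsmul _ _),
    iUnion_Ioc_add_zsmul (by positivity), setLIntegral_univ]

lemma lintegral_exp_neg_mul_sq {b : ℝ} (hb : 0 < b) :
    ∫⁻ z, ENNReal.ofReal (rexp (-b * z ^ 2)) = ENNReal.ofReal √(π / b) := by
  rw [← integral_gaussian, ofReal_integral_eq_lintegral_ofReal (integrable_exp_neg_mul_sq hb)]
  exact ae_of_all _ fun _ => (exp_pos _).le

lemma lintegral_heatGauss {t : ℝ} (ht : 0 < t) :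
    ∫⁻ z, ENNReal.ofReal (heatGauss t z) = 1 := by
  have h : ∀ z, ENNReal.ofReal (heatGauss t z) =
      ENNReal.ofReal (1 / √(4 * π * t)) * ENNReal.ofReal (rexp (-(1 / (4 * t)) * z ^ 2)) := by
    intro z
    rw [← ENNReal.ofReal_mul (by positivity), heatGauss]
    congr 1
    field_simp
  simp_rw [h]
  rw [lintegral_const_mul _ (by fun_prop), lintegral_exp_neg_mul_sq (by positivity),
    ← ENNReal.ofReal_mul (by positivity), show π / (1 / (4 * t)) = 4 * π * t by field_simp,
    one_div_mul_cancel (by positivity), ENNReal.ofReal_one]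

lemma lintegral_heatGauss_sq {t : ℝ} (ht : 0 < t) :
    ∫⁻ z, ENNReal.ofReal (heatGauss t z) ^ 2 = ENNReal.ofReal (1 / √(8 * π * t)) := by
  have h : ∀ z, ENNReal.ofReal (heatGauss t z) ^ 2 =
      ENNReal.ofReal (1 / (4 * π * t)) * ENNReal.ofReal (rexp (-(1 / (2 * t)) * z ^ 2)) := by
    intro z
    rw [← ENNReal.ofReal_mul (by positivity), ← ENNReal.ofReal_pow (heatGauss_nonneg _ _),
      heatGauss, div_pow, Real.sq_sqrt (by positivity), ← Real.exp_nat_mul]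
    congr 1
    rw [div_eq_mul_one_div, mul_comm]
    congr 2
    push_cast
    field_simp
    ring
  simp_rw [h]
  rw [lintegral_const_mul _ (by fun_prop), lintegral_exp_neg_mul_sq (by positivity),
    ← ENNReal.ofReal_mul (by positivity)]
  congr 1
  rw [← Real.sqrt_sq (show 0 ≤ 1 / (4 * π * t) by positivity), ← Real.sqrt_mul (by positivity),
    ← Real.sqrt_one, ← Real.sqrt_div (by positivity)]
  congr 1
  field_simp
  norm_num

lemma setLIntegral_neumannHeatKernelENN {L t : ℝ} (hL : 0 < L) (ht : 0 < t) (x : ℝ) :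
    ∫⁻ y in Ioc 0 L, neumannHeatKernelENN L t x y = 1 := by
  have hm : Measurable fun z => ENNReal.ofReal (heatGauss t z) := by
    unfold heatGauss; fun_prop
  exact (setLIntegral_tsum_images hL x hm).trans (lintegral_heatGauss ht)

lemma le_setLIntegral_neumannHeatKernelENN_sq {L t : ℝ} (hL : 0 < L) (ht : 0 < t) (x : ℝ) :
    ENNReal.ofReal (1 / √(8 * π * t)) ≤ ∫⁻ y in Ioc 0 L, neumannHeatKernelENN L t x y ^ 2 := by
  have hm : Measurable fun z => ENNReal.ofReal (heatGauss t z) ^ 2 := by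
    unfold heatGauss; fun_prop
  rw [← lintegral_heatGauss_sq ht, ← setLIntegral_tsum_images hL x hm]
  refine lintegral_mono fun y => ?_
  simp only
  rw [sq (neumannHeatKernelENN L t x y)]
  nth_rw 1 [neumannHeatKernelENN]
  rw [← ENNReal.tsum_mul_right]
  refine ENNReal.tsum_le_tsum fun n => ?_
  set A := ENNReal.ofReal (heatGauss t (x - y - 2 * (n : ℝ) * L)) with hA
  set B := ENNReal.ofReal (heatGauss t (x + y - 2 * (n : ℝ) * L)) with hB
  have hAB : A + B ≤ neumannHeatKernelENN L t x y := by
    unfold neumannHeatKernelENN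
    exact ENNReal.le_tsum (f := fun n : ℤ => ENNReal.ofReal (heatGauss t (x - y - 2 * (n : ℝ) * L))
      + ENNReal.ofReal (heatGauss t (x + y - 2 * (n : ℝ) * L))) n
  calc A ^ 2 + B ^ 2 ≤ (A + B) * (A + B) := by
        rw [add_mul, sq, sq]
        gcongr
        · exact le_self_add
        · exact le_add_self
    _ ≤ _ := by gcongr

lemma heatGauss_sub_le {L T t z : ℝ} (ht : 0 < t) (htT : t ≤ T) (hz : |z| ≤ 2 * L) (n : ℤ) :
    heatGauss t (z - 2 * n * L) ≤ rexp (L ^ 2 / T) * rexp (-(L ^ 2 / (2 * T)) * n ^ 2) / √t := by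
  have hT : 0 < T := ht.trans_le htT
  have hz2 : z ^ 2 ≤ (2 * L) ^ 2 := sq_le_sq' (neg_le_of_abs_le hz) (le_of_abs_le hz)
  unfold heatGauss
  rw [← Real.exp_add]
  gcongr
  · calc -(z - 2 * n * L) ^ 2 / (4 * t) = -((z - 2 * n * L) ^ 2 / (4 * t)) := by ring
      _ ≤ -((z - 2 * n * L) ^ 2 / (4 * T)) := by gcongr
      _ ≤ -((2 * n ^ 2 * L ^ 2 - 4 * L ^ 2) / (4 * T)) := by
        gcongr
        nlinarith [sq_nonneg (z - n * L)]
      _ = L ^ 2 / T + -(L ^ 2 / (2 * T)) * n ^ 2 := by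
        field_simp
        ring
  · nlinarith [Real.pi_gt_three]

lemma summable_int_exp_neg_mul_sq {c : ℝ} (hc : 0 < c) :
    Summable fun n : ℤ => rexp (-c * (n : ℝ) ^ 2) := by
  have h : Summable fun n : ℕ => rexp (-c * (n : ℝ) ^ 2) := by
    refine (Real.summable_exp_nat_mul_iff.mpr (neg_lt_zero.mpr hc)).of_nonneg_of_le
      (fun _ => (exp_pos _).le) fun n => Real.exp_le_exp.mpr ?_
    have : (n : ℝ) ≤ (n : ℝ) ^ 2 := by exact_mod_cast Nat.le_self_pow two_ne_zero n
    nlinarith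
  refine Summable.of_nat_of_neg ?_ ?_ <;> simpa using h

lemma exists_neumannHeatKernelENN_le {L T : ℝ} (hL : 0 < L) (hT : 0 < T) :
    ∃ B : ℝ, 0 < B ∧ ∀ t ≤ T, ∀ x ∈ Icc 0 L, ∀ y ∈ Icc 0 L,
      neumannHeatKernelENN L t x y ≤ ENNReal.ofReal (B / √t) := by
  have hsum := summable_int_exp_neg_mul_sq (show 0 < L ^ 2 / (2 * T) by positivity)
  have hpos := hsum.tsum_pos (fun _ => (exp_pos _).le) 0 (exp_pos _)
  refine ⟨2 * rexp (L ^ 2 / T) * ∑' n : ℤ, rexp (-(L ^ 2 / (2 * T)) * (n : ℝ) ^ 2),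
    by positivity, fun t htT x hx y hy => ?_⟩
  rcases le_or_gt t 0 with ht | ht
  · simp [neumannHeatKernelENN_of_nonpos ht]
  rw [mul_div_right_comm, ← tsum_mul_left, ENNReal.ofReal_tsum_of_nonneg (fun _ => by positivity)
    (hsum.mul_left _)]
  refine ENNReal.tsum_le_tsum fun n => ?_
  rw [← ENNReal.ofReal_add (heatGauss_nonneg _ _) (heatGauss_nonneg _ _)]
  refine ENNReal.ofReal_le_ofReal ?_
  have h1 := heatGauss_sub_le (L := L) (z := x - y) ht htT
    (abs_le.mpr ⟨by linarith [hx.1, hy.2], by linarith [hx.2, hy.1]⟩) n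
  have h2 := heatGauss_sub_le (L := L) (z := x + y) ht htT
    (abs_le.mpr ⟨by linarith [hx.1, hy.1], by linarith [hx.2, hy.2]⟩) n
  calc _ ≤ _ := add_le_add h1 h2
    _ = _ := by ring

lemma setLIntegral_neumannHeatKernelENN_sq_le {L t B x : ℝ} (hL : 0 < L)
    (hB : ∀ y ∈ Icc 0 L, neumannHeatKernelENN L t x y ≤ ENNReal.ofReal (B / √t)) :
    ∫⁻ y in Ioc 0 L, neumannHeatKernelENN L t x y ^ 2 ≤ ENNReal.ofReal (B / √t) := by
  rcases le_or_gt t 0 with ht | ht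
  · simp [neumannHeatKernelENN_of_nonpos ht]
  calc ∫⁻ y in Ioc 0 L, neumannHeatKernelENN L t x y ^ 2
      ≤ ∫⁻ y in Ioc 0 L, ENNReal.ofReal (B / √t) * neumannHeatKernelENN L t x y := by
        refine setLIntegral_mono_ae' measurableSet_Ioc (ae_of_all _ fun y hy => ?_)
        rw [sq]
        gcongr
        exact hB y (Ioc_subset_Icc_self hy)
    _ = ENNReal.ofReal (B / √t) := by
        rw [lintegral_const_mul' _ _ ENNReal.ofReal_ne_top,
          setLIntegral_neumannHeatKernelENN hL ht, mul_one]

lemma setLIntegral_inv_sqrt_mul_exp_le {B β : ℝ} (hB : 0 < B) (hβ : 0 < β) (t : ℝ) :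
    ∫⁻ s in Ioc 0 t, ENNReal.ofReal (B / √(t - s)) * ENNReal.ofReal (rexp (β * s)) ≤
      ENNReal.ofReal (B * √(π / β) * rexp (β * t)) := by
  have hGamma : ∫ u in Ioi (0 : ℝ), u ^ ((1 / 2 : ℝ) - 1) * rexp (-(β * u)) = √(π / β) := by
    rw [Real.integral_rpow_mul_exp_neg_mul_Ioi (by norm_num) hβ, Real.Gamma_one_half_eq,
      ← Real.sqrt_eq_rpow, ← Real.sqrt_mul (by positivity)]
    congr 1
    ring
  have hint : IntegrableOn (fun u : ℝ => u ^ ((1 / 2 : ℝ) - 1) * rexp (-(β * u))) (Ioi 0) := by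
    by_contra h
    rw [integral_undef h] at hGamma
    have : 0 < √(π / β) := by positivity
    linarith
  have hm : Measurable fun u : ℝ => ENNReal.ofReal (B * rexp (β * t)) *
      ENNReal.ofReal (1 / √u * rexp (-(β * u))) := by fun_prop
  calc ∫⁻ s in Ioc 0 t, ENNReal.ofReal (B / √(t - s)) * ENNReal.ofReal (rexp (β * s))
      = ∫⁻ s in Ioc 0 t, ENNReal.ofReal (B * rexp (β * t)) *
          ENNReal.ofReal (1 / √(t - s) * rexp (-(β * (t - s)))) := by
        refine lintegral_congr fun s => ?_
        rw [← ENNReal.ofReal_mul (by positivity), ← ENNReal.ofReal_mul (by positivity),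
          show β * s = β * t + -(β * (t - s)) by ring, Real.exp_add]
        congr 1
        ring
    _ ≤ ∫⁻ s in Iic t, ENNReal.ofReal (B * rexp (β * t)) *
          ENNReal.ofReal (1 / √(t - s) * rexp (-(β * (t - s)))) :=
        lintegral_mono_set fun s hs => hs.2
    _ = ∫⁻ u in Ici 0, ENNReal.ofReal (B * rexp (β * t)) *
          ENNReal.ofReal (1 / √u * rexp (-(β * u))) := by
        rw [← (Measure.measurePreserving_sub_left volume t).setLIntegral_comp_preimage
          measurableSet_Ici hm, preimage_const_sub_Ici, sub_zero]
    _ = ∫⁻ u in Ioi 0, ENNReal.ofReal (B * rexp (β * t)) *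
          ENNReal.ofReal (u ^ ((1 / 2 : ℝ) - 1) * rexp (-(β * u))) := by
        rw [setLIntegral_congr Ioi_ae_eq_Ici.symm]
        refine setLIntegral_congr_fun measurableSet_Ioi fun u hu => ?_
        rw [show (1 / 2 : ℝ) - 1 = -(1 / 2) by norm_num, Real.rpow_neg (le_of_lt hu),
          ← Real.sqrt_eq_rpow, one_div]
    _ = ENNReal.ofReal (B * √(π / β) * rexp (β * t)) := by
        rw [lintegral_const_mul' _ _ ENNReal.ofReal_ne_top, ← ofReal_integral_eq_lintegral_ofReal hint,
          hGamma, ← ENNReal.ofReal_mul (by positivity)]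
        · congr 1
          ring
        · refine (ae_restrict_iff' measurableSet_Ioi).mpr (ae_of_all _ fun u hu => ?_)
          have : 0 < u := hu
          simp only [Pi.zero_apply]
          positivity

/-- Geometric decay of the iterates in an exponentially weighted supremum norm. -/
lemma exists_iterate_heatSqOpENN_le {L T M : ℝ} (hL : 0 < L) (hT : 0 < T) (hM : 0 < M) :
    ∃ β : ℝ, ∀ k : ℕ, ∀ t ∈ Icc 0 T, ∀ x ∈ Icc 0 L,
      ((heatSqOpENN L)^[k] fun _ _ => 1) t x ≤ ENNReal.ofReal (M ^ k * rexp (β * t)) := by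
  obtain ⟨B, hB, hK⟩ := exists_neumannHeatKernelENN_le hL hT
  set β := π * (B / M) ^ 2 with hβ_def
  have hβ : 0 < β := by positivity
  have hBM : B * √(π / β) = M := by
    rw [hβ_def, div_mul_cancel_left₀ Real.pi_ne_zero, Real.sqrt_inv, Real.sqrt_sq (by positivity)]
    field_simp
  refine ⟨β, fun k => ?_⟩
  induction k with
  | zero =>
    intro t ht x _
    simpa using mul_nonneg hβ.le ht.1
  | succ k ih =>
    intro t ht x hx
    rw [Function.iterate_succ_apply']
    set ψ := (heatSqOpENN L)^[k] fun _ _ => 1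
    calc heatSqOpENN L ψ t x
        ≤ ∫⁻ s in Ioc 0 t, ENNReal.ofReal (M ^ k) *
            (ENNReal.ofReal (B / √(t - s)) * ENNReal.ofReal (rexp (β * s))) := by
          refine setLIntegral_mono_ae' measurableSet_Ioc (ae_of_all _ fun s hs => ?_)
          calc ∫⁻ y in Ioc 0 L, neumannHeatKernelENN L (t - s) x y ^ 2 * ψ s y
              ≤ ∫⁻ y in Ioc 0 L, neumannHeatKernelENN L (t - s) x y ^ 2 *
                  ENNReal.ofReal (M ^ k * rexp (β * s)) := by
                refine setLIntegral_mono_ae' measurableSet_Ioc (ae_of_all _ fun y hy => ?_)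
                gcongr
                exact ih s ⟨hs.1.le, hs.2.trans ht.2⟩ y (Ioc_subset_Icc_self hy)
            _ ≤ ENNReal.ofReal (B / √(t - s)) * ENNReal.ofReal (M ^ k * rexp (β * s)) := by
                rw [lintegral_mul_const' _ _ ENNReal.ofReal_ne_top]
                gcongr
                exact setLIntegral_neumannHeatKernelENN_sq_le hL
                  (hK (t - s) (by linarith [hs.1, ht.2]) x hx)
            _ = _ := by
                rw [ENNReal.ofReal_mul (by positivity)]
                ring
      _ ≤ ENNReal.ofReal (M ^ k) * ENNReal.ofReal (B * √(π / β) * rexp (β * t)) := by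
          rw [lintegral_const_mul' _ _ ENNReal.ofReal_ne_top]
          gcongr
          exact setLIntegral_inv_sqrt_mul_exp_le hB hβ t
      _ = ENNReal.ofReal (M ^ (k + 1) * rexp (β * t)) := by
          rw [hBM, ← ENNReal.ofReal_mul (by positivity), pow_succ, mul_assoc (M ^ k)]

lemma iterate_heatSqOp_eq_toReal {L T : ℝ} (hL : 0 < L) (hT : 0 < T) (k : ℕ) :
    ∀ t ∈ Icc 0 T, ∀ x ∈ Icc 0 L, ((heatSqOp L)^[k] fun _ _ => 1) t x =
      (((heatSqOpENN L)^[k] fun _ _ => 1) t x).toReal := by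
  obtain ⟨B, hB, hK⟩ := exists_neumannHeatKernelENN_le hL hT
  obtain ⟨β, hβ⟩ := exists_iterate_heatSqOpENN_le hL hT one_pos
  induction k with
  | zero => simp
  | succ k ih =>
    intro t ht x hx
    have hψ := measurable_iterate_heatSqOpENN L k
    have hψT := hβ k
    rw [Function.iterate_succ_apply', Function.iterate_succ_apply']
    set φ := (heatSqOp L)^[k] fun _ _ => 1
    set ψ := (heatSqOpENN L)^[k] fun _ _ => 1
    have hm := measurable_heatSqOpENN_integrand L hψ
    have hinner : ∀ s ∈ Ioc 0 t,
        ∫ y in (0 : ℝ)..L, neumannHeatKernel L (t - s) x y ^ 2 * φ s y =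
          (∫⁻ y in Ioc 0 L, neumannHeatKernelENN L (t - s) x y ^ 2 * ψ s y).toReal := by
      intro s hs
      have hsT : s ∈ Icc 0 T := ⟨hs.1.le, hs.2.trans ht.2⟩
      rw [intervalIntegral.integral_of_le hL.le, ← integral_toReal]
      · refine setIntegral_congr_fun measurableSet_Ioc fun y hy => ?_
        rw [ih s hsT y (Ioc_subset_Icc_self hy), neumannHeatKernel_eq_toReal, ENNReal.toReal_mul,
          ENNReal.toReal_pow]
      · exact (hm.comp (f := fun y : ℝ => (((t, x), s), y)) (by fun_prop)).aemeasurable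
      · refine (ae_restrict_iff' measurableSet_Ioc).mpr (ae_of_all _ fun y hy => ?_)
        have hy' := Ioc_subset_Icc_self hy
        exact ENNReal.mul_lt_top (ENNReal.pow_lt_top
          ((hK (t - s) (by linarith [hs.1, ht.2]) x hx y hy').trans_lt ENNReal.ofReal_lt_top))
          ((hψT s hsT y hy').trans_lt ENNReal.ofReal_lt_top)
    unfold heatSqOp heatSqOpENN
    rw [intervalIntegral.integral_of_le ht.1, ← integral_toReal]
    · exact setIntegral_congr_fun measurableSet_Ioc hinner
    · exact (hm.lintegral_prod_right'.comp (f := fun s : ℝ => ((t, x), s))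
        (by fun_prop)).aemeasurable
    · refine (ae_lt_top' ?_ ?_)
      · exact (hm.lintegral_prod_right'.comp (f := fun s : ℝ => ((t, x), s))
          (by fun_prop)).aemeasurable
      · have h := (hβ (k + 1) t ht x hx).trans_lt ENNReal.ofReal_lt_top
        rw [Function.iterate_succ_apply'] at h
        exact h.ne

lemma le_heatSqOpENN {L t x : ℝ} (hL : 0 < L) {ψ : ℝ → ℝ → ℝ≥0∞} {g : ℝ → ℝ≥0∞}
    (hg : ∀ s ∈ Ioc 0 t, ∀ y ∈ Icc 0 L, g s ≤ ψ s y) :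
    ∫⁻ s in Ioc 0 t, ENNReal.ofReal (1 / √(8 * π * (t - s))) * g s ≤ heatSqOpENN L ψ t x := by
  refine setLIntegral_mono_ae' measurableSet_Ioc (ae_of_all _ fun s hs => ?_)
  rcases hs.2.eq_or_lt with rfl | hst
  · simp
  calc ENNReal.ofReal (1 / √(8 * π * (t - s))) * g s
      ≤ (∫⁻ y in Ioc 0 L, neumannHeatKernelENN L (t - s) x y ^ 2) * g s := by
        gcongr
        exact le_setLIntegral_neumannHeatKernelENN_sq hL (sub_pos.mpr hst) x
    _ ≤ ∫⁻ y in Ioc 0 L, neumannHeatKernelENN L (t - s) x y ^ 2 * g s :=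
        lintegral_mul_const_le _ _
    _ ≤ _ := by
        refine setLIntegral_mono_ae' measurableSet_Ioc (ae_of_all _ fun y hy => ?_)
        gcongr
        exact hg s hs y (Ioc_subset_Icc_self hy)

lemma inv_le_inv_sqrt_mul_inv_sqrt {r s t : ℝ} (hrs : r < s) (hst : s < t) :
    1 / (4 * π) * (1 / (t - r)) ≤ 1 / √(8 * π * (t - s)) * (1 / √(8 * π * (s - r))) := by
  have h1 : 0 < t - s := sub_pos.mpr hst
  have h2 : 0 < s - r := sub_pos.mpr hrs
  have h3 : 0 < t - r := by linarith
  rw [one_div_mul_one_div, one_div_mul_one_div, ← Real.sqrt_mul (by positivity)]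
  gcongr
  rw [Real.sqrt_le_left (by positivity)]
  have : 4 * ((t - s) * (s - r)) ≤ (t - r) ^ 2 := by nlinarith [sq_nonneg (t - s - (s - r))]
  nlinarith [mul_le_mul_of_nonneg_left this (sq_nonneg π)]

/-- A lower bound for the composition of two Abel integral operators. -/
lemma le_setLIntegral_abel_abel (t : ℝ) {g : ℝ → ℝ≥0∞} (hg : Measurable g) :
    ENNReal.ofReal (1 / (4 * π)) * ∫⁻ r in Ioc 0 t, g r ≤
      ∫⁻ s in Ioc 0 t, ENNReal.ofReal (1 / √(8 * π * (t - s))) *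
        ∫⁻ r in Ioc 0 s, ENNReal.ofReal (1 / √(8 * π * (s - r))) * g r := by
  set S : Set (ℝ × ℝ) := {p | 0 < p.2 ∧ p.2 < p.1 ∧ p.1 < t} with hS_def
  have hS : MeasurableSet S :=
    (measurableSet_lt measurable_const measurable_snd).inter
      ((measurableSet_lt measurable_snd measurable_fst).inter
        (measurableSet_lt measurable_fst measurable_const))
  set G : ℝ × ℝ → ℝ≥0∞ :=
    S.indicator fun p => ENNReal.ofReal (1 / (4 * π) * (1 / (t - p.2))) * g p.2 with hG_def
  have hG : Measurable G := Measurable.indicator (by fun_prop) hS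
  calc ENNReal.ofReal (1 / (4 * π)) * ∫⁻ r in Ioc 0 t, g r
      = ∫⁻ r in Ioo 0 t, ENNReal.ofReal (1 / (4 * π)) * g r := by
        rw [setLIntegral_congr Ioo_ae_eq_Ioc, lintegral_const_mul' _ _ ENNReal.ofReal_ne_top]
    _ = ∫⁻ r in Ioo 0 t, ∫⁻ s, G (s, r) := by
        refine setLIntegral_congr_fun measurableSet_Ioo fun r hr => ?_
        have hGr : (fun s => G (s, r)) = (Ioo r t).indicator fun _ =>
            ENNReal.ofReal (1 / (4 * π) * (1 / (t - r))) * g r := by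
          ext s
          simp only [hG_def, hS_def, indicator, mem_ofPred_eq, mem_Ioo, hr.1, true_and]
        have htr : 0 < t - r := sub_pos.mpr hr.2
        rw [hGr, lintegral_indicator measurableSet_Ioo, setLIntegral_const, Real.volume_Ioo,
          mul_right_comm, ← ENNReal.ofReal_mul (by positivity), mul_assoc,
          one_div_mul_cancel htr.ne', mul_one]
    _ ≤ ∫⁻ r, ∫⁻ s, G (s, r) := setLIntegral_le_lintegral _ _
    _ = ∫⁻ s, ∫⁻ r, G (s, r) :=
        lintegral_lintegral_swap (hG.comp measurable_swap).aemeasurable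
    _ ≤ ∫⁻ s, (Ioc 0 t).indicator (fun s => ENNReal.ofReal (1 / √(8 * π * (t - s))) *
        ∫⁻ r in Ioc 0 s, ENNReal.ofReal (1 / √(8 * π * (s - r))) * g r) s := by
        refine lintegral_mono fun s => ?_
        by_cases hs : s ∈ Ioo 0 t
        · rw [indicator_of_mem (Ioo_subset_Ioc_self hs),
            ← lintegral_const_mul' _ _ ENNReal.ofReal_ne_top, ← lintegral_indicator measurableSet_Ioc]
          refine lintegral_mono fun r => ?_
          by_cases hr : (s, r) ∈ S
          · rw [hG_def, indicator_of_mem hr, indicator_of_mem (show r ∈ Ioc 0 s from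
              ⟨hr.1, hr.2.1.le⟩), ← mul_assoc, ← ENNReal.ofReal_mul (by positivity)]
            exact mul_le_mul_left (ENNReal.ofReal_le_ofReal
              (inv_le_inv_sqrt_mul_inv_sqrt hr.2.1 hr.2.2)) _
          · simp [hG_def, indicator_of_notMem hr]
        · have : ∀ r, G (s, r) = 0 := fun r => indicator_of_notMem
            (fun hr => hs ⟨hr.1.trans hr.2.1, hr.2.2⟩) _
          simp [this]
    _ = _ := lintegral_indicator measurableSet_Ioc _

lemma setLIntegral_pow {t : ℝ} (ht : 0 ≤ t) (m : ℕ) :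
    ∫⁻ r in Ioc 0 t, ENNReal.ofReal (r ^ m) = ENNReal.ofReal (t ^ (m + 1) / (m + 1)) := by
  rw [← ofReal_integral_eq_lintegral_ofReal, ← intervalIntegral.integral_of_le ht, integral_pow]
  · simp
  · exact (intervalIntegrable_iff_integrableOn_Ioc_of_le ht).mp
      (intervalIntegral.intervalIntegrable_pow m)
  · exact (ae_restrict_iff' measurableSet_Ioc).mpr (ae_of_all _ fun r hr => pow_nonneg hr.1.le m)

lemma le_iterate_two_mul_heatSqOpENN {L : ℝ} (hL : 0 < L) (m : ℕ) :
    ∀ t, 0 ≤ t → ∀ x, ENNReal.ofReal ((t / (4 * π)) ^ m / m.factorial) ≤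
      ((heatSqOpENN L)^[2 * m] fun _ _ => 1) t x := by
  induction m with
  | zero => simp
  | succ m ih =>
    intro t ht x
    rw [show 2 * (m + 1) = 2 * m + 1 + 1 by ring, Function.iterate_succ_apply',
      Function.iterate_succ_apply']
    set ψ := (heatSqOpENN L)^[2 * m] fun _ _ => 1
    have hg : Measurable fun r : ℝ => ENNReal.ofReal ((r / (4 * π)) ^ m / m.factorial) := by
      fun_prop
    calc ENNReal.ofReal ((t / (4 * π)) ^ (m + 1) / (m + 1).factorial)
        = ENNReal.ofReal (1 / (4 * π)) *
            ∫⁻ r in Ioc 0 t, ENNReal.ofReal ((r / (4 * π)) ^ m / m.factorial) := by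
          have h : ∀ r : ℝ, ENNReal.ofReal ((r / (4 * π)) ^ m / m.factorial) =
              ENNReal.ofReal (1 / ((4 * π) ^ m * m.factorial)) * ENNReal.ofReal (r ^ m) := by
            intro r
            rw [← ENNReal.ofReal_mul (by positivity), div_pow]
            congr 1
            field_simp
          simp_rw [h]
          rw [lintegral_const_mul' _ _ ENNReal.ofReal_ne_top, setLIntegral_pow ht,
            ← ENNReal.ofReal_mul (by positivity), ← ENNReal.ofReal_mul (by positivity),
            Nat.factorial_succ, div_pow, pow_succ (4 * π)]
          congr 1
          push_cast
          field_simp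
      _ ≤ _ := le_setLIntegral_abel_abel t hg
      _ ≤ heatSqOpENN L (heatSqOpENN L ψ) t x :=
          le_heatSqOpENN hL fun s hs y _ => le_heatSqOpENN hL fun r hr z _ => ih r hr.1.le z

theorem heatSqOp_series_lower_bound
    (L : ℝ) (hL : 0 < L) (a : ℝ) (ha : 0 < a) (t : ℝ) (ht : 0 < t) :
    L * Real.exp (a ^ 2 * t / (4 * π * Real.exp 1))
      ≤ ∑' k : ℕ, a ^ k * ∫ x in (0 : ℝ)..L, ((heatSqOp L)^[k] (fun _ _ => (1 : ℝ))) t x := by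
  obtain ⟨β, hβ⟩ := exists_iterate_heatSqOpENN_le hL ht (show 0 < 1 / (2 * a) by positivity)
  set u : ℕ → ℝ → ℝ := fun k x => (((heatSqOpENN L)^[k] fun _ _ => 1) t x).toReal
  have htt : t ∈ Icc 0 t := ⟨ht.le, le_rfl⟩
  have hbound (k : ℕ) : ∀ x ∈ Icc 0 L, u k x ≤ (1 / (2 * a)) ^ k * rexp (β * t) := fun x hx =>
    ENNReal.toReal_le_of_le_ofReal (by positivity) (hβ k t htt x hx)
  have hint (k : ℕ) : IntervalIntegrable (u k) volume 0 L := by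
    refine (intervalIntegrable_iff_integrableOn_Ioc_of_le hL.le).mpr
      (Measure.integrableOn_of_bounded (M := (1 / (2 * a)) ^ k * rexp (β * t)) (by simp) ?_ ?_)
    · exact (((measurable_iterate_heatSqOpENN L k).comp (f := fun x : ℝ => (t, x))
        (by fun_prop)).ennreal_toReal).aestronglyMeasurable
    · refine (ae_restrict_iff' measurableSet_Ioc).mpr (ae_of_all _ fun x hx => ?_)
      rw [Real.norm_of_nonneg ENNReal.toReal_nonneg]
      exact hbound k x (Ioc_subset_Icc_self hx)
  have hrw (k : ℕ) : ∫ x in (0 : ℝ)..L, ((heatSqOp L)^[k] fun _ _ => 1) t x =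
      ∫ x in (0 : ℝ)..L, u k x := by
    refine intervalIntegral.integral_congr fun x hx => ?_
    rw [uIcc_of_le hL.le] at hx
    exact iterate_heatSqOp_eq_toReal hL ht k t htt x hx
  simp_rw [hrw]
  have hnonneg (k : ℕ) : 0 ≤ ∫ x in (0 : ℝ)..L, u k x :=
    intervalIntegral.integral_nonneg hL.le fun _ _ => ENNReal.toReal_nonneg
  have hsummable : Summable fun k : ℕ => a ^ k * ∫ x in (0 : ℝ)..L, u k x := by
    refine (summable_geometric_two.mul_right (L * rexp (β * t))).of_nonneg_of_le
      (fun k => mul_nonneg (by positivity) (hnonneg k)) fun k => ?_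
    have h := intervalIntegral.integral_mono_on hL.le (hint k) intervalIntegrable_const (hbound k)
    rw [intervalIntegral.integral_const, smul_eq_mul, sub_zero] at h
    calc a ^ k * ∫ x in (0 : ℝ)..L, u k x
        ≤ a ^ k * (L * ((1 / (2 * a)) ^ k * rexp (β * t))) := by gcongr
      _ = (a * (1 / (2 * a))) ^ k * (L * rexp (β * t)) := by rw [mul_pow]; ring
      _ = (1 / 2) ^ k * (L * rexp (β * t)) := by
        congr 2
        field_simp
  have heven (m : ℕ) : L * ((a ^ 2 * t / (4 * π)) ^ m / m.factorial) ≤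
      a ^ (2 * m) * ∫ x in (0 : ℝ)..L, u (2 * m) x := by
    have h := intervalIntegral.integral_mono_on hL.le intervalIntegrable_const (hint (2 * m))
      (f := fun _ => (t / (4 * π)) ^ m / m.factorial) fun x hx =>
        (ENNReal.ofReal_le_iff_le_toReal ((hβ (2 * m) t htt x hx).trans_lt
          ENNReal.ofReal_lt_top).ne).mp (le_iterate_two_mul_heatSqOpENN hL m t ht.le x)
    rw [intervalIntegral.integral_const, smul_eq_mul, sub_zero] at h
    calc L * ((a ^ 2 * t / (4 * π)) ^ m / m.factorial)
        = a ^ (2 * m) * (L * ((t / (4 * π)) ^ m / m.factorial)) := by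
          rw [mul_div_assoc (a ^ 2), mul_pow, pow_mul]; ring
      _ ≤ _ := by gcongr
  have hexp : HasSum (fun m : ℕ => L * ((a ^ 2 * t / (4 * π)) ^ m / m.factorial))
      (L * rexp (a ^ 2 * t / (4 * π))) := by
    rw [Real.exp_eq_exp_ℝ]
    exact (NormedSpace.expSeries_div_hasSum_exp _).mul_left L
  calc L * rexp (a ^ 2 * t / (4 * π * rexp 1)) ≤ L * rexp (a ^ 2 * t / (4 * π)) := by
        have : 4 * π ≤ 4 * π * rexp 1 :=
          le_mul_of_one_le_right (by positivity) (Real.one_le_exp zero_le_one)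
        have : a ^ 2 * t / (4 * π * rexp 1) ≤ a ^ 2 * t / (4 * π) :=
          div_le_div_of_nonneg_left (by positivity) (by positivity) this
        gcongr L * rexp ?_
    _ = ∑' m : ℕ, L * ((a ^ 2 * t / (4 * π)) ^ m / m.factorial) := hexp.tsum_eq.symm
    _ ≤ _ := Summable.tsum_le_tsum_of_inj (fun m => 2 * m)
        (mul_right_injective₀ two_ne_zero) (fun k _ => mul_nonneg (by positivity) (hnonneg k))
        heven hexp.summable hsummable
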